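/- arXiv:1002.3962 — 2 statements merged into one kernel-verified Lean document; each statement's English description precedes it below -/
import Mathlib

section
/- Let M be a compact Hausdorff space, M_0 a closed subset of M, 𝒜 a unital C*-algebra, and f_0 : M_0 → U(𝒜) a continuous map into the unitary group of 𝒜. Then there exist an open subset O of M containing M_0 and a continuous map f : O → U(𝒜) such that the restriction of f to M_0 equals f_0. -/
open Topology

section Extension

variable {X E : Type*} [TopologicalSpace X] [CompactSpace X] [NormedAddCommGroup E]

/-- Restriction of continuous maps to a compact subset, as a normed group homomorphism. -/
noncomputable def restrictNormedAddGroupHom (E : Type*) [NormedAddCommGroup E]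
    (S : Set X) [CompactSpace S] :
    NormedAddGroupHom C(X, E) C(S, E) :=
  AddMonoidHom.mkNormedAddGroupHom
    { toFun := fun F => F.restrict S
      map_zero' := rfl
      map_add' := fun _ _ => rfl } 1 fun F => by
    rw [one_mul]
    exact (ContinuousMap.norm_le _ (norm_nonneg F)).2 fun x => F.norm_coe_le_norm x

@[simp]
theorem restrictNormedAddGroupHom_apply (S : Set X) [CompactSpace S] (F : C(X, E)) (x : S) :
    restrictNormedAddGroupHom E S F x = F x := rfl

variable [NormedSpace ℝ E]

/-- A map in the range of the restriction has an extension that does not increase the norm. -/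
theorem surjectiveOnWith_restrictNormedAddGroupHom_range (S : Set X) [CompactSpace S] :
    (restrictNormedAddGroupHom E S).SurjectiveOnWith (restrictNormedAddGroupHom E S).range 1 := by
  rintro _ ⟨F, rfl⟩
  set g := restrictNormedAddGroupHom E S F with hg
  rcases eq_or_ne g 0 with h0 | h0
  · exact ⟨0, by rw [map_zero]; exact h0.symm, by simp⟩
  have hpos : 0 < ‖g‖ := norm_pos_iff.2 h0
  have hmax (x : X) : 0 < max ‖g‖ ‖F x‖ := lt_max_of_lt_left hpos
  refine ⟨⟨fun x => (‖g‖ / max ‖g‖ ‖F x‖) • F x, ?_⟩, ?_, ?_⟩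
  · exact (continuous_const.div (by fun_prop) fun x => (hmax x).ne').smul F.continuous
  · ext x
    have hx : ‖F x‖ ≤ ‖g‖ := g.norm_coe_le_norm x
    change (‖g‖ / max ‖g‖ ‖F x‖) • F x = F x
    rw [max_eq_left hx, div_self hpos.ne', one_smul]
  · rw [one_mul]
    refine (ContinuousMap.norm_le _ hpos.le).2 fun x => ?_
    change ‖(‖g‖ / max ‖g‖ ‖F x‖) • F x‖ ≤ ‖g‖
    rw [norm_smul, Real.norm_of_nonneg (div_nonneg hpos.le (hmax x).le), div_mul_eq_mul_div,
      div_le_iff₀ (hmax x)]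
    exact mul_le_mul_of_nonneg_left (le_max_right _ _) hpos.le

theorem topologicalClosure_range_restrictNormedAddGroupHom [T2Space X] {S : Set X}
    (hS : IsClosed S) [CompactSpace S] :
    (restrictNormedAddGroupHom E S).range.topologicalClosure = ⊤ := by
  refine eq_top_iff.2 fun g _ => ?_
  refine Metric.mem_closure_iff.2 fun ε hε => ?_
  obtain ⟨G, hG⟩ := exists_continuous_forall_mem_convex_of_local_const
    (t := fun x : X => {y : E | ∀ h : x ∈ S, y ∈ Metric.ball (g ⟨x, h⟩) (ε / 2)})
    (fun x => by
      simp only [Set.ofPred_forall]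
      exact convex_iInter fun h => convex_ball _ _)
    (fun x => by
      by_cases hx : x ∈ S
      · refine ⟨g ⟨x, hx⟩, ?_⟩
        have h1 : ∀ᶠ y in 𝓝 (⟨x, hx⟩ : S), g ⟨x, hx⟩ ∈ Metric.ball (g y) (ε / 2) := by
          filter_upwards [g.continuous.continuousAt (Metric.ball_mem_nhds _ (half_pos hε))] with y hy
          exact Metric.mem_ball_comm.1 hy
        rw [nhds_subtype_eq_comap, Filter.eventually_comap] at h1
        filter_upwards [h1] with y hy h
        exact hy ⟨y, h⟩ rfl
      · refine ⟨0, ?_⟩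
        filter_upwards [hS.isOpen_compl.mem_nhds hx] with y hy h
        exact absurd h hy)
  refine ⟨_, ⟨G, rfl⟩, lt_of_le_of_lt ?_ (half_lt_self hε)⟩
  refine (ContinuousMap.dist_le (half_pos hε).le).2 fun x => ?_
  rw [dist_comm]
  exact (Metric.mem_ball.1 (hG x x.2)).le

/-- **Tietze extension theorem** for maps from a compact Hausdorff space to a Banach space. -/
theorem exists_continuousMap_extension [T2Space X] [CompleteSpace E] {S : Set X}
    (hS : IsClosed S) (g : C(S, E)) : ∃ F : C(X, E), ∀ x : S, F x = g x := by
  have : CompactSpace S := isCompact_iff_compactSpace.1 hS.isCompact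
  obtain ⟨F, hF, -⟩ := controlled_closure_of_complete one_pos one_pos
    (surjectiveOnWith_restrictNormedAddGroupHom_range (E := E) S) g
    (by rw [topologicalClosure_range_restrictNormedAddGroupHom hS]; trivial)
  exact ⟨F, fun x => by rw [← hF]; rfl⟩

end Extension

section Polar

variable {A : Type*} [CStarAlgebra A] [PartialOrder A] [StarOrderedRing A]

/-- The polar part `a (a⋆ a)^(-1/2)`, which is unitary when `a` is invertible. -/
noncomputable def polarPart (a : A) : A := a * Ring.inverse (CFC.sqrt (star a * a))

theorem isUnit_sqrt_star_mul_self {a : A} (ha : IsUnit a) : IsUnit (CFC.sqrt (star a * a)) :=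
  (CFC.isUnit_sqrt_iff _ (star_mul_self_nonneg a)).2 (ha.star.mul ha)

theorem polarPart_mem_unitary {a : A} (ha : IsUnit a) : polarPart a ∈ unitary A := by
  obtain ⟨s, hs⟩ := isUnit_sqrt_star_mul_self ha
  have hsq : (s : A) * s = star a * a := by
    rw [hs, CFC.sqrt_mul_sqrt_self _ (star_mul_self_nonneg a)]
  have hsa : star (s : A) = s := by
    rw [hs]
    exact (IsSelfAdjoint.of_nonneg (CFC.sqrt_nonneg _)).star_eq
  have hsi : star (↑s⁻¹ : A) = ↑s⁻¹ := by
    rw [← Units.coe_star, star_inv, show star s = s from Units.ext hsa]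
  have hp : polarPart a = a * ↑s⁻¹ := by rw [polarPart, ← hs, Ring.inverse_unit]
  have hu : IsUnit (polarPart a) := hp ▸ ha.mul s⁻¹.isUnit
  have h1 : star (polarPart a) * polarPart a = 1 := by
    rw [hp, star_mul, hsi, mul_assoc, ← mul_assoc (star a), ← hsq, mul_assoc (s : A),
      Units.mul_inv, mul_one, Units.inv_mul]
  exact Unitary.mem_iff.2 ⟨h1, hu.mul_right_cancel (by rw [mul_assoc, h1, mul_one, one_mul])⟩

theorem polarPart_of_mem_unitary {a : A} (ha : a ∈ unitary A) : polarPart a = a := by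
  rw [polarPart, (Unitary.mem_iff.1 ha).1, CFC.sqrt_one, Ring.inverse_one, mul_one]

theorem continuousOn_polarPart : ContinuousOn (polarPart (A := A)) {a | IsUnit a} := by
  refine continuousOn_id.mul fun a ha => ?_
  obtain ⟨s, hs⟩ := isUnit_sqrt_star_mul_self ha
  have hsqrt : Continuous fun a : A => CFC.sqrt (star a * a) :=
    CFC.continuousOn_sqrt.comp_continuous (by fun_prop) star_mul_self_nonneg
  refine (ContinuousAt.comp (g := Ring.inverse) ?_ hsqrt.continuousAt).continuousWithinAt
  rw [← hs]
  exact NormedRing.inverse_continuousAt s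

end Polar

/-- A continuous unitary-valued map on a closed subset `M₀` of a compact Hausdorff
space `M` extends to a continuous unitary-valued map on an open set `O ⊇ M₀`. -/
theorem stmt_1 {M : Type*} [TopologicalSpace M] [CompactSpace M] [T2Space M]
    {𝒜 : Type*} [CStarAlgebra 𝒜]
    (M₀ : Set M) (hM₀ : IsClosed M₀)
    (f₀ : M₀ → unitary 𝒜) (hf₀ : Continuous f₀) :
    ∃ O : Set M, IsOpen O ∧ ∃ (hsub : M₀ ⊆ O) (f : O → unitary 𝒜),
      Continuous f ∧ ∀ x : M₀, f (Set.inclusion hsub x) = f₀ x := by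
  let _ : PartialOrder 𝒜 := CStarAlgebra.spectralOrder 𝒜
  have _ : StarOrderedRing 𝒜 := CStarAlgebra.spectralOrderedRing 𝒜
  obtain ⟨F, hF⟩ := exists_continuousMap_extension hM₀
    (⟨fun x => (f₀ x : 𝒜), continuous_subtype_val.comp hf₀⟩ : C(M₀, 𝒜))
  have hF' (x : M₀) : F x = f₀ x := hF x
  refine ⟨{x | IsUnit (F x)}, Units.isOpen.preimage F.continuous, fun x hx => ?_,
    fun x => ⟨polarPart (F x), polarPart_mem_unitary x.2⟩, ?_, fun x => Subtype.ext ?_⟩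
  · change IsUnit (F (⟨x, hx⟩ : M₀))
    rw [hF']
    exact (Unitary.toUnits (f₀ ⟨x, hx⟩)).isUnit
  · exact (continuousOn_polarPart.comp_continuous
      (F.continuous.comp continuous_subtype_val) fun x => x.2).subtype_mk _
  · change polarPart (F x) = f₀ x
    rw [hF', polarPart_of_mem_unitary (f₀ x).2]
end

section
/- Let 𝒜 be a unital C*-algebra, n ≥ 2, and let P ∈ M_n(𝒜) be a projection (P = P* = P²) that is approximately diagonalizable, i.e. for every ε > 0 there exist a unitary W ∈ M_n(𝒜) and elements a_1,…,a_n ∈ 𝒜 with ‖WPW* − diag(a_1,…,a_n)‖ < ε. Then there exist a unitary U ∈ M_n(𝒜) and projections p_1,…,p_n ∈ 𝒜 such that UPU* = diag(p_1,…,p_n). -/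
open scoped ComplexStarModule

section CStarNorm

variable {B : Type*} [CStarAlgebra B]

/-- Any norm satisfying the C*-identity on a C*-algebra is dominated by the given norm. -/
lemma cstarNorm_le_norm (nrm : B → ℝ)
    (nrm_def : ∀ X, nrm X = 0 ↔ X = 0)
    (nrm_add : ∀ X Y, nrm (X + Y) ≤ nrm X + nrm Y)
    (nrm_smul : ∀ (c : ℂ) X, nrm (c • X) = ‖c‖ * nrm X)
    (nrm_star : ∀ X, nrm (star X * X) = nrm X ^ 2) (x : B) : nrm x ≤ ‖x‖ := by
  let := CStarAlgebra.spectralOrder B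
  have := CStarAlgebra.spectralOrderedRing B
  have unitary_le {u : B} (hu : u ∈ unitary B) : nrm u ≤ 1 := by
    have h1 := nrm_star (1 : B)
    have h2 := nrm_star u
    rw [star_one, one_mul] at h1
    rw [Unitary.star_mul_self_of_mem hu] at h2
    have h3 : nrm 1 ≤ 1 := by nlinarith [sq_nonneg (nrm 1 - 1)]
    nlinarith
  have ball_le (a : selfAdjoint B) (ha : ‖a‖ ≤ 1) : nrm a ≤ 1 := by
    have hu := (selfAdjoint.unitarySelfAddISMul a ha).2
    have hr := congrArg (Subtype.val) (selfAdjoint.realPart_unitarySelfAddISMul a ha)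
    rw [realPart_apply_coe] at hr
    set u : B := (selfAdjoint.unitarySelfAddISMul a ha : B)
    have hr' : ((2⁻¹ : ℝ) : ℂ) • (u + star u) = (a : B) := by
      rw [← hr, Complex.coe_smul]
    rw [← hr', nrm_smul]
    have h3 := nrm_add u (star u)
    have h4 := unitary_le hu
    have h5 := unitary_le (Unitary.star_mem hu)
    have h6 : ‖((2⁻¹ : ℝ) : ℂ)‖ = 2⁻¹ := by simp
    rw [h6]
    linarith
  have selfAdjoint_le {a : B} (ha : IsSelfAdjoint a) : nrm a ≤ ‖a‖ := by
    by_cases h0 : a = 0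
    · simp [h0, (nrm_def 0).2 rfl]
    have hpos : 0 < ‖a‖ := norm_pos_iff.2 h0
    have hsa : IsSelfAdjoint ((‖a‖⁻¹ : ℝ) • a) := IsSelfAdjoint.smul (IsSelfAdjoint.all _) ha
    have h1 := ball_le ⟨(‖a‖⁻¹ : ℝ) • a, hsa⟩ (by
      change ‖(‖a‖⁻¹ : ℝ) • a‖ ≤ 1
      rw [norm_smul, norm_inv, norm_norm, inv_mul_cancel₀ hpos.ne'])
    have h2 : nrm ((‖a‖⁻¹ : ℝ) • a) = ‖a‖⁻¹ * nrm a := by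
      rw [← Complex.coe_smul, nrm_smul]
      simp
    change nrm ((‖a‖⁻¹ : ℝ) • a) ≤ 1 at h1
    rw [h2, inv_mul_le_iff₀ hpos] at h1
    linarith
  have h := selfAdjoint_le (IsSelfAdjoint.star_mul_self x)
  rw [nrm_star, CStarRing.norm_star_mul_self, ← sq] at h
  exact le_of_sq_le_sq h (norm_nonneg x)

/-- A submultiplicative norm satisfying the C*-identity on a C*-algebra dominates
the given norm, even if it is not assumed complete. -/
lemma norm_le_cstarNorm (nrm : B → ℝ)
    (nrm_def : ∀ X, nrm X = 0 ↔ X = 0)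
    (nrm_add : ∀ X Y, nrm (X + Y) ≤ nrm X + nrm Y)
    (nrm_smul : ∀ (c : ℂ) X, nrm (c • X) = ‖c‖ * nrm X)
    (nrm_mul : ∀ X Y, nrm (X * Y) ≤ nrm X * nrm Y)
    (nrm_star : ∀ X, nrm (star X * X) = nrm X ^ 2) (x : B) : ‖x‖ ≤ nrm x := by
  let := CStarAlgebra.spectralOrder B
  have := CStarAlgebra.spectralOrderedRing B
  have nrm_nonneg (y : B) : 0 ≤ nrm y := by
    have h1 := nrm_add y ((-1 : ℂ) • y)
    rw [nrm_smul, neg_one_smul, add_neg_cancel, (nrm_def 0).2 rfl] at h1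
    norm_num at h1
    linarith
  suffices nonneg_le : ∀ a : B, 0 ≤ a → ‖a‖ ≤ nrm a by
    have h := nonneg_le _ (star_mul_self_nonneg x)
    rw [nrm_star, CStarRing.norm_star_mul_self, ← sq] at h
    exact le_of_sq_le_sq h (nrm_nonneg x)
  intro a ha
  by_contra! hlt
  obtain ⟨r, hr1, hr2⟩ := exists_between hlt
  have hr : 0 < r := (nrm_nonneg a).trans_lt hr1
  have ha' : IsSelfAdjoint a := .of_nonneg ha
  have : Nontrivial B := ⟨a, 0, by rintro rfl; simp at hr2; linarith⟩
  let f : ℝ → ℝ := fun t ↦ max (t - r) 0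
  let h : ℕ → ℝ → ℝ := fun k t ↦ f t * (max t r)⁻¹ ^ k
  have hmax (t : ℝ) : 0 < max t r := lt_max_of_lt_right hr
  have hf : Continuous f := by fun_prop
  have hh (k : ℕ) : Continuous (h k) :=
    hf.mul (((continuous_id.max continuous_const).inv₀ fun t ↦ (hmax t).ne').pow k)
  have hmul (k : ℕ) : cfc f a = a ^ k * cfc (h k) a := by
    have hp : a ^ k = cfc (fun t : ℝ ↦ t ^ k) a := by rw [cfc_pow_id (R := ℝ) a k]
    rw [hp, ← cfc_mul (fun t : ℝ ↦ t ^ k) (h k) a (by fun_prop) (hh k).continuousOn]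
    refine cfc_congr fun t _ ↦ ?_
    rcases le_total t r with htr | htr
    · simp [h, f, htr]
    · have : t ≠ 0 := (hr.trans_le htr).ne'
      simp only [h, f, max_eq_left htr, inv_pow]
      field_simp
  have hbound (k : ℕ) : ‖cfc (h k) a‖ ≤ ‖a‖ * r⁻¹ ^ k := by
    refine norm_cfc_le (by positivity) fun t ht ↦ ?_
    have ht0 := spectrum_nonneg_of_nonneg ha ht
    have ht1 : t ≤ ‖a‖ := (le_abs_self t).trans (spectrum.norm_le_norm_of_mem ht)
    have hf0 : 0 ≤ f t := le_max_right _ _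
    have hf1 : f t ≤ ‖a‖ := max_le (by linarith) (norm_nonneg a)
    rw [Real.norm_of_nonneg (mul_nonneg hf0 (pow_nonneg (inv_nonneg.2 (hmax t).le) k))]
    have : (max t r)⁻¹ ≤ r⁻¹ := inv_anti₀ hr (le_max_right t r)
    have := inv_nonneg.2 (hmax t).le
    gcongr
  have hpow (k : ℕ) : nrm (a ^ (k + 1)) ≤ nrm a ^ (k + 1) := by
    induction k with
    | zero => simp
    | succ k ih =>
      rw [pow_succ, pow_succ (nrm a)]
      exact (nrm_mul _ _).trans (mul_le_mul_of_nonneg_right ih (nrm_nonneg a))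
  have hle (k : ℕ) : nrm (cfc f a) ≤ ‖a‖ * (nrm a / r) ^ (k + 1) := by
    rw [hmul (k + 1)]
    calc nrm (a ^ (k + 1) * cfc (h (k + 1)) a)
        ≤ nrm a ^ (k + 1) * (‖a‖ * r⁻¹ ^ (k + 1)) := by
          refine (nrm_mul _ _).trans (mul_le_mul (hpow k) ?_ (nrm_nonneg _)
            (pow_nonneg (nrm_nonneg a) _))
          exact (cstarNorm_le_norm nrm nrm_def nrm_add nrm_smul nrm_star _).trans (hbound _)
      _ = ‖a‖ * (nrm a / r) ^ (k + 1) := by rw [div_eq_mul_inv, mul_pow]; ring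
  have hlim : Filter.Tendsto (fun k : ℕ ↦ ‖a‖ * (nrm a / r) ^ (k + 1)) Filter.atTop (nhds 0) := by
    have := (tendsto_pow_atTop_nhds_zero_of_lt_one (div_nonneg (nrm_nonneg a) hr.le)
      ((div_lt_one hr).2 hr1)).const_mul ‖a‖
    rw [mul_zero] at this
    exact this.comp (Filter.tendsto_add_atTop_nat 1)
  have hzero : cfc f a = 0 := (nrm_def _).1
    (le_antisymm (ge_of_tendsto' hlim hle) (nrm_nonneg _))
  have := norm_apply_le_norm_cfc f a (CStarAlgebra.norm_mem_spectrum_of_nonneg ha)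
    hf.continuousOn ha'
  rw [hzero, norm_zero, norm_le_zero_iff] at this
  have := le_max_left (‖a‖ - r) 0
  simp only [f] at *
  linarith

end CStarNorm

section Projections

variable {B : Type*} [CStarAlgebra B]

/-- Projections at distance less than one in a C*-algebra are unitarily equivalent. -/
lemma exists_unitary_conj_eq_of_norm_sub_lt_one {p q : B}
    (hp : IsStarProjection p) (hq : IsStarProjection q) (h : ‖p - q‖ < 1) :
    ∃ u ∈ unitary B, u * p * star u = q := by
  have hpp : p * p = p := hp.isIdempotentElem
  have hqq : q * q = q := hq.isIdempotentElem
  have hps : star p = p := hp.isSelfAdjoint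
  have hqs : star q = q := hq.isSelfAdjoint
  let s : B := q * p + (1 - q) * (1 - p)
  let d : B := 1 - (p - q) * (p - q)
  have hs : star s = p * q + (1 - p) * (1 - q) := by simp [s, hps, hqs]
  have hpp' (x : B) : p * (p * x) = p * x := by rw [← mul_assoc, hpp]
  have hqq' (x : B) : q * (q * x) = q * x := by rw [← mul_assoc, hqq]
  have hss : star s * s = d := by
    rw [hs]
    simp only [s, d, mul_add, add_mul, mul_sub, sub_mul, mul_one, one_mul, mul_assoc, hpp, hqq,
      hqq']
    abel
  have hss' : s * star s = d := by
    rw [hs]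
    simp only [s, d, mul_add, add_mul, mul_sub, sub_mul, mul_one, one_mul, mul_assoc, hpp, hqq,
      hpp']
    abel
  have hsp : s * p = q * s := by
    simp only [s, mul_add, add_mul, mul_sub, sub_mul, mul_one, one_mul, mul_assoc, hpp, hqq,
      hqq']
    abel
  have hdp : Commute d p := by
    simp only [Commute, SemiconjBy, d, mul_sub, sub_mul, mul_one, one_mul, mul_assoc, hpp, hqq,
      hpp']
    abel
  have hds : Commute d s := by
    change d * s = s * d
    nth_rw 1 [← hss']
    rw [← hss, mul_assoc]
  have hd : IsSelfAdjoint d := by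
    rw [← hss]
    exact IsSelfAdjoint.star_mul_self s
  have hspec : ∀ t ∈ spectrum ℝ d, 0 < t := by
    intro t ht
    have h1 : 1 - t ∈ spectrum ℝ (1 - d) := by
      have := spectrum.sub_singleton_eq (R := ℝ) d 1
      have h2 := spectrum.singleton_sub_eq (R := ℝ) d 1
      rw [map_one] at h2
      rw [← h2]
      exact Set.sub_mem_sub (Set.mem_singleton _) ht
    have h2 : ‖1 - d‖ < 1 := by
      have : 1 - d = (p - q) * (p - q) := by simp [d]
      rw [this]
      calc _ ≤ ‖p - q‖ * ‖p - q‖ := norm_mul_le _ _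
        _ < 1 := by nlinarith [norm_nonneg (p - q)]
    have : Nontrivial B := by
      by_contra hB
      rw [not_nontrivial_iff_subsingleton] at hB
      simp [spectrum.of_subsingleton] at ht
    have h3 := (spectrum.norm_le_norm_of_mem h1).trans_lt h2
    rw [Real.norm_eq_abs, abs_lt] at h3
    linarith
  let w : B := cfc (fun t : ℝ ↦ (√t)⁻¹) d
  have hcont : ContinuousOn (fun t : ℝ ↦ (√t)⁻¹) (spectrum ℝ d) :=
    Real.continuous_sqrt.continuousOn.inv₀ fun t ht ↦ (Real.sqrt_pos.2 (hspec t ht)).ne'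
  have hw : star w = w := (cfc_predicate (fun t : ℝ ↦ (√t)⁻¹) d : IsSelfAdjoint w)
  have hwp : w * p = p * w := hdp.cfc_real _
  have hws : w * s = s * w := hds.cfc_real _
  have hwd : w * d = d * w := (Commute.refl d).cfc_real _
  have hwwd : d * w * w = 1 := by
    have h1 : d * w * w = cfc (fun t : ℝ ↦ t * (√t)⁻¹ * (√t)⁻¹) d := by
      rw [cfc_mul (fun t : ℝ ↦ t * (√t)⁻¹) (fun t ↦ (√t)⁻¹) d
        (continuousOn_id.mul hcont) hcont, cfc_mul (fun t : ℝ ↦ t) (fun t ↦ (√t)⁻¹) d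
        continuousOn_id hcont, cfc_id' ℝ d]
    rw [h1, ← cfc_one ℝ d]
    refine cfc_congr fun t ht ↦ ?_
    have ht0 := hspec t ht
    have := Real.sqrt_pos.2 ht0
    have h2 := Real.mul_self_sqrt ht0.le
    simp only [Pi.one_apply]
    field_simp
    nlinarith
  have hws' : w * star s = star s * w := by
    have := congrArg star hws
    rw [star_mul, star_mul, hw] at this
    exact this.symm
  refine ⟨s * w, ⟨?_, ?_⟩, ?_⟩
  · rw [star_mul, hw, mul_assoc, ← mul_assoc (star s), hss, ← mul_assoc, hwd, hwwd]
  · rw [star_mul, hw, hws', mul_assoc, ← mul_assoc w, hws', mul_assoc, ← mul_assoc, hss',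
      ← mul_assoc, hwwd]
  · calc s * w * p * star (s * w) = s * (w * p) * (w * star s) := by
          rw [star_mul, hw]; noncomm_ring
      _ = s * p * w * (w * star s) := by rw [hwp]; noncomm_ring
      _ = q * (s * (w * w * star s)) := by rw [hsp]; noncomm_ring
      _ = q * (s * star s * w * w) := by rw [mul_assoc w, hws', ← mul_assoc w, hws']; noncomm_ring
      _ = q := by rw [hss', hwwd, mul_one]

/-- A self-adjoint element that is almost idempotent is close to a projection. -/
lemma exists_isStarProjection_norm_sub_le {b : B} (hb : IsSelfAdjoint b) {δ : ℝ}
    (hδ : δ ≤ 1 / 8) (h : ‖b * b - b‖ ≤ δ) :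
    ∃ q : B, IsStarProjection q ∧ ‖q - b‖ ≤ 2 * δ := by
  have hδ0 : 0 ≤ δ := (norm_nonneg _).trans h
  let f : ℝ → ℝ := fun t ↦ max 0 (min 1 (4 * t - 3 / 2))
  have hf : Continuous f := by fun_prop
  have hspec : ∀ t ∈ spectrum ℝ b, |t * t - t| ≤ δ := by
    intro t ht
    have h1 : cfc (fun t : ℝ ↦ t * t - t) b = b * b - b := by
      rw [cfc_sub (fun t : ℝ ↦ t * t) (fun t ↦ t) b, cfc_mul (fun t : ℝ ↦ t) (fun t ↦ t) b,
        cfc_id' ℝ b]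
    have h2 := norm_apply_le_norm_cfc (fun t : ℝ ↦ t * t - t) b ht
    rw [h1] at h2
    exact h2.trans h
  have hdich : ∀ t ∈ spectrum ℝ b, (f t = 0 ∧ |t| ≤ 2 * δ) ∨ (f t = 1 ∧ |1 - t| ≤ 2 * δ) := by
    intro t ht
    have h1 := abs_le.1 (hspec t ht)
    rcases le_total t (1 / 2) with h2 | h2
    · left
      have h3 : |t| ≤ 2 * δ := abs_le.2 ⟨by nlinarith, by nlinarith⟩
      have h4 := abs_le.1 h3
      refine ⟨max_eq_left (min_le_of_right_le (by linarith)), h3⟩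
    · right
      have h3 : |1 - t| ≤ 2 * δ := abs_le.2 ⟨by nlinarith, by nlinarith⟩
      have h4 := abs_le.1 h3
      have h5 : min 1 (4 * t - 3 / 2) = 1 := min_eq_left (by linarith)
      exact ⟨by simp [f, h5], h3⟩
  refine ⟨cfc f b, ⟨?_, cfc_predicate f b⟩, ?_⟩
  · change cfc f b * cfc f b = cfc f b
    rw [← cfc_mul f f b hf.continuousOn hf.continuousOn]
    refine cfc_congr fun t ht ↦ ?_
    rcases hdich t ht with h1 | h1 <;> simp [h1.1]
  · have h1 : cfc f b - b = cfc (fun t ↦ f t - t) b := by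
      rw [cfc_sub f (fun t ↦ t) b hf.continuousOn continuousOn_id, cfc_id' ℝ b]
    rw [h1]
    refine norm_cfc_le (by positivity) fun t ht ↦ ?_
    rcases hdich t ht with h1 | h1
    · simpa [h1.1] using h1.2
    · simpa [h1.1] using h1.2

/-- A projection close to a C*-subalgebra is unitarily equivalent to a projection in the
subalgebra. -/
lemma exists_unitary_conj_eq_map_of_norm_sub_lt {D : Type*} [CStarAlgebra D] (φ : D →⋆ₐ[ℂ] B)
    (hφ : Function.Injective φ) {p : B} (hp : IsStarProjection p) {a : D}
    (ha : ‖p - φ a‖ < 1 / 32) :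
    ∃ u ∈ unitary B, ∃ q : D, IsStarProjection q ∧ u * p * star u = φ q := by
  let b : D := ℜ a
  have hb : IsSelfAdjoint b := (ℜ a).2
  have hpb : ‖p - φ b‖ < 1 / 32 := by
    have h1 : p - φ b = (ℜ (p - φ a) : B) := by
      rw [map_sub, AddSubgroupClass.coe_sub, hp.isSelfAdjoint.coe_realPart]
      simp only [b, realPart_apply_coe, ← Complex.coe_smul, map_smul, map_add, map_star]
    rw [h1]
    exact (realPart.norm_le _).trans_lt ha
  have hnorm (x : D) : ‖φ x‖ = ‖x‖ := NonUnitalStarAlgHom.norm_map φ hφ x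
  have hpp : p * p = p := hp.isIdempotentElem
  have hp1 : ‖p‖ ≤ 1 := hp.norm_le
  have hbb : ‖b * b - b‖ ≤ 1 / 8 := by
    rw [← hnorm]
    set e : B := p - φ b with he
    have h1 : φ (b * b - b) = e * e - p * e - e * p + e := by
      simp only [he, map_sub, map_mul, mul_sub, sub_mul, hpp]
      abel
    rw [h1]
    have h2 : ‖e * e‖ ≤ ‖e‖ * ‖e‖ := norm_mul_le _ _
    have h3 : ‖p * e‖ ≤ ‖p‖ * ‖e‖ := norm_mul_le _ _
    have h4 : ‖e * p‖ ≤ ‖e‖ * ‖p‖ := norm_mul_le _ _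
    have h5 := norm_add_le (e * e - p * e - e * p) e
    have h6 := norm_sub_le (e * e - p * e) (e * p)
    have h7 := norm_sub_le (e * e) (p * e)
    nlinarith [norm_nonneg e, norm_nonneg p]
  obtain ⟨q, hq, hqb⟩ := exists_isStarProjection_norm_sub_le hb le_rfl hbb
  have hpq : ‖p - φ q‖ < 1 := by
    have h1 : p - φ q = (p - φ b) - φ (q - b) := by rw [map_sub]; abel
    rw [h1]
    have h2 := norm_sub_le (p - φ b) (φ (q - b))
    rw [hnorm] at h2
    linarith
  obtain ⟨u, hu, hup⟩ := exists_unitary_conj_eq_of_norm_sub_lt_one hp (hq.map φ) hpq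
  exact ⟨u, hu, q, hq, hup⟩

end Projections

/-- Finite products of C*-algebras are C*-algebras. -/
@[reducible]
noncomputable def Pi.cstarAlgebra (ι A : Type*) [Fintype ι] [CStarAlgebra A] :
    CStarAlgebra (ι → A) where

/-- The diagonal embedding into the matrices over a C*-algebra. -/
noncomputable def CStarMatrix.diagonalStarAlgHom (ι A : Type*) [Fintype ι] [DecidableEq ι]
    [CStarAlgebra A] [PartialOrder A] [StarOrderedRing A] : (ι → A) →⋆ₐ[ℂ] CStarMatrix ι ι A where
  toFun a := CStarMatrix.ofMatrix (Matrix.diagonal a)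
  map_one' := Matrix.diagonal_one
  map_mul' a b := (Matrix.diagonal_mul_diagonal a b).symm
  map_zero' := Matrix.diagonal_zero
  map_add' a b := (Matrix.diagonal_add a b).symm
  commutes' c := (Matrix.diagonalAlgHom ℂ (n := ι) (α := A)).commutes c
  map_star' a := (Matrix.diagonal_conjTranspose a).symm


/-- An approximately diagonalizable projection in `Mₙ(𝒜)` (`𝒜` a unital C*-algebra)
is unitarily equivalent to a diagonal of projections.  Here `nrm` is the (unique)
C*-norm on `Mₙ(𝒜)`, specified axiomatically. -/
theorem stmt_8 {𝒜 : Type*} [CStarAlgebra 𝒜] (n : ℕ) (hn : 2 ≤ n)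
    (nrm : Matrix (Fin n) (Fin n) 𝒜 → ℝ)
    (nrm_def : ∀ X, nrm X = 0 ↔ X = 0)
    (nrm_add : ∀ X Y, nrm (X + Y) ≤ nrm X + nrm Y)
    (nrm_smul : ∀ (c : ℂ) X, nrm (c • X) = ‖c‖ * nrm X)
    (nrm_mul : ∀ X Y, nrm (X * Y) ≤ nrm X * nrm Y)
    (nrm_star : ∀ X, nrm (star X * X) = nrm X ^ 2)
    (P : Matrix (Fin n) (Fin n) 𝒜) (hP : IsSelfAdjoint P) (hP2 : P * P = P)
    (hAD : ∀ ε > 0, ∃ W ∈ unitary (Matrix (Fin n) (Fin n) 𝒜), ∃ a : Fin n → 𝒜,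
      nrm (W * P * star W - Matrix.diagonal a) < ε) :
    ∃ U ∈ unitary (Matrix (Fin n) (Fin n) 𝒜), ∃ p : Fin n → 𝒜,
      (∀ i, IsSelfAdjoint (p i) ∧ p i * p i = p i) ∧
      U * P * star U = Matrix.diagonal p := by
  let := CStarAlgebra.spectralOrder 𝒜
  have := CStarAlgebra.spectralOrderedRing 𝒜
  let := Pi.cstarAlgebra (Fin n) 𝒜
  obtain ⟨W, hW, a, ha⟩ := hAD (1 / 32) (by norm_num)
  have hle : ∀ X : CStarMatrix (Fin n) (Fin n) 𝒜, ‖X‖ ≤ nrm X :=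
    norm_le_cstarNorm (B := CStarMatrix (Fin n) (Fin n) 𝒜) nrm nrm_def nrm_add nrm_smul nrm_mul
      nrm_star
  let φ := CStarMatrix.diagonalStarAlgHom (Fin n) 𝒜
  have hφ : Function.Injective φ := Matrix.diagonal_injective
  have hproj : IsStarProjection (W * P * star W) := by
    refine ⟨?_, hP.conjugate W⟩
    change W * P * star W * (W * P * star W) = W * P * star W
    calc W * P * star W * (W * P * star W) = W * P * (star W * W) * P * star W := by noncomm_ring
      _ = W * (P * P) * star W := by
        rw [Unitary.star_mul_self_of_mem hW]; noncomm_ring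
      _ = W * P * star W := by rw [hP2]
  obtain ⟨u, hu, q, hq, huq⟩ := exists_unitary_conj_eq_map_of_norm_sub_lt
    (B := CStarMatrix (Fin n) (Fin n) 𝒜) φ hφ (p := W * P * star W)
    ⟨hproj.isIdempotentElem, hproj.isSelfAdjoint⟩ (a := a) ((hle _).trans_lt ha)
  let V : Matrix (Fin n) (Fin n) 𝒜 := u
  have hV : V ∈ unitary (Matrix (Fin n) (Fin n) 𝒜) := hu
  have hVq : V * (W * P * star W) * star V = Matrix.diagonal q := huq
  refine ⟨V * W, mul_mem hV hW, q, fun i ↦ ⟨?_, ?_⟩, ?_⟩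
  · exact congrFun hq.isSelfAdjoint i
  · exact congrFun hq.isIdempotentElem i
  · rw [← hVq, star_mul]
    noncomm_ring
end
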